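/- arXiv:2603.23734 — 2 statements merged into one kernel-verified Lean document; each statement's English description precedes it below -/
import Mathlib

section
/- Let Φ : (0,1) → (0,∞) satisfy Φ(r) = o((1-r)^{-2}) as r → 1⁻, i.e., (1-r)² Φ(r) → 0 as r → 1⁻. Then there exists a holomorphic function p_Φ on the open unit disc 𝔻 with Re p_Φ(z) > 0 for all z ∈ 𝔻 such that limsup_{r→1⁻} I_{p_Φ}(r)/Φ(r) = +∞; in particular I_{p_Φ}(r) ≠ O(Φ(r)) as r → 1⁻. -/
open Filter Set

/-- The integral mean `I_p(r) = ∫₀^{2π} |z p'(z)/p(z)|² dθ`, `z = r e^{iθ}`. -/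
noncomputable def Ip (p : ℂ → ℂ) (r : ℝ) : ℝ :=
  ∫ θ in (0:ℝ)..(2 * Real.pi),
    ‖(↑r * Complex.exp (↑θ * Complex.I)) * deriv p (↑r * Complex.exp (↑θ * Complex.I)) /
      p (↑r * Complex.exp (↑θ * Complex.I))‖ ^ 2

/-- The exponentials `θ ↦ e^{imθ}` with `m ≠ 0` an integer have mean zero over a period. -/
theorem integral_exp_int_mul_I (m : ℤ) (hm : m ≠ 0) :
    ∫ θ in (0:ℝ)..(2 * Real.pi), Complex.exp ((m * Complex.I) * (θ : ℂ)) = 0 := by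
  have hc : (m * Complex.I : ℂ) ≠ 0 := mul_ne_zero (by exact_mod_cast hm) Complex.I_ne_zero
  rw [integral_exp_mul_complex hc]
  have h : Complex.exp ((m * Complex.I) * ((2 * Real.pi : ℝ) : ℂ)) = 1 := by
    rw [Complex.exp_eq_one_iff]
    exact ⟨m, by push_cast; ring⟩
  rw [h]
  simp

/-- Bessel's inequality for a single coefficient of an absolutely convergent trigonometric
series with distinct frequencies. -/
theorem two_pi_mul_sq_le_integral_norm_tsum_sq {b : ℕ → ℝ} (hb0 : ∀ k, 0 ≤ b k)
    (hb : Summable b) {n : ℕ → ℕ} (hn : Function.Injective n) (j : ℕ) :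
    2 * Real.pi * b j ^ 2 ≤ ∫ θ in (0:ℝ)..(2 * Real.pi),
      ‖∑' k, (b k : ℂ) * Complex.exp (θ * Complex.I) ^ n k‖ ^ 2 := by
  set f : ℝ → ℂ := fun θ => ∑' k, (b k : ℂ) * Complex.exp (θ * Complex.I) ^ n k with hf
  set e : ℝ → ℂ := fun θ => Complex.exp ((-(n j : ℤ) : ℂ) * Complex.I * θ) with he
  have hnorm : ∀ k (θ : ℝ), ‖(b k : ℂ) * Complex.exp (θ * Complex.I) ^ n k‖ = b k := by
    intro k θ
    simp [Complex.norm_exp_ofReal_mul_I, abs_of_nonneg (hb0 k)]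
  have hfc : Continuous f :=
    continuous_tsum (fun k => by fun_prop) hb fun k θ => (hnorm k θ).le
  have hec : Continuous e := by fun_prop
  have hen : ∀ θ, ‖e θ‖ = 1 := by
    intro θ
    have : e θ = Complex.exp (((-(n j : ℝ) * θ : ℝ) : ℂ) * Complex.I) := by
      simp only [he]; congr 1; push_cast; ring
    rw [this, Complex.norm_exp_ofReal_mul_I]
  have hterm : ∀ k (θ : ℝ), (b k : ℂ) * Complex.exp (θ * Complex.I) ^ n k * e θ =
      b k * Complex.exp ((((n k : ℤ) - n j : ℤ) * Complex.I) * (θ : ℂ)) := by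
    intro k θ
    simp only [he]
    rw [← Complex.exp_nat_mul, mul_assoc, ← Complex.exp_add]
    congr 2; push_cast; ring
  have hcoef : ∫ θ in (0:ℝ)..(2 * Real.pi), f θ * e θ = ((2 * Real.pi * b j : ℝ) : ℂ) := by
    have hsum := intervalIntegral.hasSum_integral_of_dominated_convergence
      (a := (0:ℝ)) (b := 2 * Real.pi) (μ := MeasureTheory.volume)
      (F := fun k (θ : ℝ) => (b k : ℂ) * Complex.exp (θ * Complex.I) ^ n k * e θ)
      (f := fun θ => f θ * e θ) (fun k _ => b k)
      (fun k => (by fun_prop : Continuous _).aestronglyMeasurable)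
      (fun k => Eventually.of_forall fun θ _ => by rw [norm_mul, hnorm, hen, mul_one])
      (Eventually.of_forall fun _ _ => hb) (by simp)
      (Eventually.of_forall fun θ _ =>
        ((hb.of_norm_bounded fun k => (hnorm k θ).le : Summable _).hasSum.mul_right (e θ)))
    refine hsum.unique ?_
    have hint : (fun k => ∫ θ in (0:ℝ)..(2 * Real.pi),
        (b k : ℂ) * Complex.exp (θ * Complex.I) ^ n k * e θ) =
        fun k => if k = j then ((2 * Real.pi * b j : ℝ) : ℂ) else 0 := by
      ext k
      rw [intervalIntegral.integral_congr fun θ _ => hterm k θ,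
        intervalIntegral.integral_const_mul]
      split_ifs with hk
      · subst hk
        simp; ring
      · rw [integral_exp_int_mul_I _ (sub_ne_zero.2 fun h => hk (hn (by exact_mod_cast h))),
          mul_zero]
    exact hint ▸ hasSum_ite_eq j _
  have hre : ∫ θ in (0:ℝ)..(2 * Real.pi), (f θ * e θ).re = 2 * Real.pi * b j := by
    have := Complex.reCLM.intervalIntegral_comp_comm (μ := MeasureTheory.volume)
      ((hfc.mul hec).intervalIntegrable 0 (2 * Real.pi))
    simp only [Complex.reCLM_apply, Pi.mul_apply] at this
    rw [this]
    have h2 := congrArg Complex.re hcoef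
    rwa [Complex.ofReal_re] at h2
  have hrec : Continuous fun θ => (f θ * e θ).re := Complex.continuous_re.comp (hfc.mul hec)
  calc 2 * Real.pi * b j ^ 2
      = ∫ θ in (0:ℝ)..(2 * Real.pi), (2 * b j * (f θ * e θ).re - b j ^ 2) := by
        rw [intervalIntegral.integral_sub ((hrec.const_mul _).intervalIntegrable _ _)
          (by simp), intervalIntegral.integral_const_mul, hre]
        simp; ring
    _ ≤ ∫ θ in (0:ℝ)..(2 * Real.pi), ‖f θ‖ ^ 2 := by
        refine intervalIntegral.integral_mono (by positivity)
          (((hrec.const_mul _).sub continuous_const).intervalIntegrable _ _)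
          ((hfc.norm.pow 2).intervalIntegrable _ _) fun θ => ?_
        have h1 : (f θ * e θ).re ≤ ‖f θ‖ := by
          simpa [hen] using Complex.re_le_norm (f θ * e θ)
        nlinarith [sq_nonneg (‖f θ‖ - b j), mul_le_mul_of_nonneg_left h1 (hb0 j)]

theorem norm_ofReal_mul_pow_le {c : ℝ} (hc : 0 ≤ c) (m : ℕ) {w : ℂ}
    (hw : w ∈ Metric.ball (0:ℂ) 1) : ‖(c : ℂ) * w ^ m‖ ≤ c := by
  rw [norm_mul, norm_pow, Complex.norm_real, Real.norm_of_nonneg hc]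
  exact mul_le_of_le_one_right hc (pow_le_one₀ (norm_nonneg _) (mem_ball_zero_iff.1 hw).le)

/-- For `p = exp h` with `h = ∑ a_k z^{n_k}` absolutely convergent on the closed disc, each
coefficient of `h` bounds the integral mean of `p` from below. -/
theorem le_Ip_exp_tsum {a : ℕ → ℝ} (ha0 : ∀ k, 0 ≤ a k) (ha : Summable a) {n : ℕ → ℕ}
    (hn : Function.Injective n) {r : ℝ} (hr0 : 0 < r) (hr1 : r < 1) (j : ℕ) :
    2 * Real.pi * (a j * n j * r ^ n j) ^ 2 ≤
      Ip (fun z => Complex.exp (∑' k, (a k : ℂ) * z ^ n k)) r := by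
  have hF_le : ∀ k (w : ℂ), w ∈ Metric.ball (0:ℂ) 1 → ‖(a k : ℂ) * w ^ n k‖ ≤ a k :=
    fun k _ hw => norm_ofReal_mul_pow_le (ha0 k) (n k) hw
  have hd : ∀ k, DifferentiableOn ℂ (fun w : ℂ => (a k : ℂ) * w ^ n k) (Metric.ball 0 1) :=
    fun k => by fun_prop
  have hmul : ∀ z ∈ Metric.ball (0:ℂ) 1,
      HasSum (fun k => ((a k * n k : ℝ) : ℂ) * z ^ n k)
        (z * deriv (fun w => ∑' k, (a k : ℂ) * w ^ n k) z) := by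
    intro z hz
    have hterm : (fun k => z * deriv (fun w : ℂ => (a k : ℂ) * w ^ n k) z) =
        fun k => ((a k * n k : ℝ) : ℂ) * z ^ n k := by
      ext k
      rw [deriv_const_mul_field, deriv_pow_field]
      rcases Nat.eq_zero_or_pos (n k) with h | h
      · simp [h]
      · obtain ⟨m, hm⟩ := Nat.exists_eq_succ_of_ne_zero h.ne'
        rw [hm]
        push_cast
        simp only [Nat.succ_eq_add_one]
        ring
    exact hterm ▸
      (Complex.hasSum_deriv_of_summable_norm ha hd Metric.isOpen_ball hF_le hz).mul_left z
  have hdiff : DifferentiableOn ℂ (fun w => ∑' k, (a k : ℂ) * w ^ n k) (Metric.ball 0 1) :=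
    Complex.differentiableOn_tsum_of_summable_norm ha hd Metric.isOpen_ball hF_le
  have hball : ∀ θ : ℝ, (r : ℂ) * Complex.exp (θ * Complex.I) ∈ Metric.ball (0:ℂ) 1 := by
    intro θ
    rw [mem_ball_zero_iff, norm_mul, Complex.norm_exp_ofReal_mul_I, Complex.norm_real,
      Real.norm_of_nonneg hr0.le, mul_one]
    exact hr1
  have hsum : Summable fun k => a k * n k * r ^ n k := by
    have h := (hmul r (by simpa using hball 0)).summable
    exact_mod_cast h
  refine (two_pi_mul_sq_le_integral_norm_tsum_sq
    (fun k => mul_nonneg (mul_nonneg (ha0 k) (Nat.cast_nonneg _)) (pow_nonneg hr0.le _))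
    hsum hn j).trans_eq ?_
  unfold Ip
  congr 1
  ext θ
  congr 2
  set z := (r : ℂ) * Complex.exp (θ * Complex.I) with hz
  have hder := ((hdiff.differentiableAt
    (Metric.isOpen_ball.mem_nhds (hball θ))).hasDerivAt.cexp).deriv
  rw [← hz] at hder
  rw [hder, mul_left_comm, mul_div_cancel_left₀ _ (Complex.exp_ne_zero _),
    ← (hmul z (hball θ)).tsum_eq]
  congr 1
  ext k
  rw [hz]
  push_cast
  ring

/-- Optimality of the gauge: if `Φ(r) = o((1-r)^{-2})` as `r → 1⁻`, then some
`p_Φ ∈ 𝒫` satisfies `limsup_{r→1⁻} I_{p_Φ}(r)/Φ(r) = +∞`. -/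
theorem stmt3 (Φ : ℝ → ℝ) (hΦpos : ∀ r ∈ Set.Ioo (0:ℝ) 1, 0 < Φ r)
    (hΦ : Tendsto (fun r : ℝ => (1 - r) ^ 2 * Φ r) (nhdsWithin 1 (Set.Iio 1)) (nhds 0)) :
    ∃ p : ℂ → ℂ, DifferentiableOn ℂ p (Metric.ball (0:ℂ) 1) ∧
      (∀ z ∈ Metric.ball (0:ℂ) 1, 0 < (p z).re) ∧
      ∀ M : ℝ, ∃ᶠ r in nhdsWithin (1:ℝ) (Set.Iio 1), M < Ip p r / Φ r := by
  set a : ℕ → ℝ := fun k => 1 / 2 / 2 ^ k with ha_def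
  have ha_pos : ∀ k, 0 < a k := fun k => by positivity
  have ha_sum : HasSum a 1 := hasSum_geometric_two' 1
  set ρ : ℕ → ℝ := fun m => 1 - 1 / (2 * m) with hρ
  have hρ_lim : Tendsto ρ atTop (nhdsWithin 1 (Set.Iio 1)) := by
    refine tendsto_nhdsWithin_iff.2 ⟨?_, ?_⟩
    · have h := (tendsto_one_div_atTop_nhds_zero_nat (𝕜 := ℝ)).const_mul (1 / 2)
      have h2 := h.const_sub 1
      simp only [mul_zero, sub_zero] at h2
      refine h2.congr fun m => ?_
      simp only [hρ]; ring
    · filter_upwards [eventually_gt_atTop 0] with m hm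
      have : (0:ℝ) < m := by exact_mod_cast hm
      simp only [hρ, Set.mem_Iio, sub_lt_self_iff]
      positivity
  obtain ⟨n, hn_mono, hn⟩ := extraction_forall_of_eventually
    (P := fun k m => 1 ≤ m ∧ (1 - ρ m) ^ 2 * Φ (ρ m) < a k ^ 2 / (4 * (k + 1)))
    fun k => (eventually_ge_atTop 1).and
      ((hΦ.comp hρ_lim).eventually_lt_const (by have := ha_pos k; positivity))
  have hF_le : ∀ k (w : ℂ), w ∈ Metric.ball (0:ℂ) 1 → ‖(a k : ℂ) * w ^ n k‖ ≤ a k :=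
    fun k _ hw => norm_ofReal_mul_pow_le (ha_pos k).le (n k) hw
  refine ⟨fun z => Complex.exp (∑' k, (a k : ℂ) * z ^ n k), ?_, ?_, ?_⟩
  · exact (Complex.differentiableOn_tsum_of_summable_norm ha_sum.summable
      (fun k => by fun_prop) Metric.isOpen_ball hF_le).cexp
  · intro z hz
    have h1 : ‖∑' k, (a k : ℂ) * z ^ n k‖ ≤ 1 :=
      tsum_of_norm_bounded ha_sum fun k => hF_le k z hz
    have h2 := abs_le.1 ((Complex.abs_im_le_norm _).trans h1)
    have hpi := Real.pi_gt_three
    rw [Complex.exp_re]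
    exact mul_pos (Real.exp_pos _)
      (Real.cos_pos_of_mem_Ioo ⟨by linarith [h2.1], by linarith [h2.2]⟩)
  · intro M
    refine (hρ_lim.comp hn_mono.tendsto_atTop).frequently (Eventually.frequently ?_)
    filter_upwards [eventually_ge_atTop ⌈M⌉₊] with k hk
    obtain ⟨hk1, hkΦ⟩ := hn k
    have hM : M ≤ k := (Nat.le_ceil M).trans (by exact_mod_cast hk)
    have hnk : (1:ℝ) ≤ n k := by exact_mod_cast hk1
    have hinv : 1 / (2 * (n k : ℝ)) ≤ 1 / 2 :=
      one_div_le_one_div_of_le two_pos (by linarith)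
    have hinv_pos : 0 < 1 / (2 * (n k : ℝ)) := by positivity
    have hr0 : 0 < ρ (n k) := by simp only [hρ]; linarith
    have hr1 : ρ (n k) < 1 := by simp only [hρ]; linarith
    have hΦk := hΦpos _ ⟨hr0, hr1⟩
    have hpow : 1 / 2 ≤ ρ (n k) ^ n k := by
      have h := one_add_mul_le_pow (a := -(1 / (2 * (n k : ℝ)))) (by linarith) (n k)
      have h2 : 1 + (n k : ℝ) * -(1 / (2 * (n k : ℝ))) = 1 / 2 := by
        field_simp; norm_num
      rwa [h2, ← sub_eq_add_neg] at h
    have hIp := le_Ip_exp_tsum (fun k => (ha_pos k).le) ha_sum.summable hn_mono.injective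
      hr0 hr1 k
    have hsq : (a k * n k * (1 / 2)) ^ 2 ≤ (a k * n k * ρ (n k) ^ n k) ^ 2 := by
      have := ha_pos k
      gcongr
    have hlow : (a k * n k) ^ 2 ≤
        Ip (fun z => Complex.exp (∑' k, (a k : ℂ) * z ^ n k)) (ρ (n k)) := by
      refine le_trans ?_ hIp
      nlinarith [Real.pi_gt_three, sq_nonneg (a k * n k)]
    have hup : (k + 1) * Φ (ρ (n k)) < (a k * n k) ^ 2 := by
      have h1 : 1 - ρ (n k) = 1 / (2 * n k) := by simp only [hρ]; ring
      rw [h1, lt_div_iff₀ (by positivity)] at hkΦ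
      have h2 : (1 / (2 * (n k : ℝ))) ^ 2 * Φ (ρ (n k)) * (4 * (k + 1)) =
          (k + 1) * Φ (ρ (n k)) / (n k : ℝ) ^ 2 := by
        field_simp; ring
      rwa [h2, div_lt_iff₀ (by positivity), ← mul_pow] at hkΦ
    rw [Function.comp_apply, lt_div_iff₀ hΦk]
    nlinarith
end

section
/- Let p*(z) = exp((i/2) ∑_{k=1}^{∞} z^{2^k}/k²) on the open unit disc, and let r_k = e^{-2^{-k}} for k ≥ 1. Then r_k^{2^{k+1}} = e^{-2}, 2^{-k-1} ≤ 1 - r_k ≤ 2^{-k}, and I_{p*}(r_k) ≥ 2π e^{-2} · 4^{k-1}/k⁴ for every k ≥ 1. -/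
open Filter Set

open Complex in
theorem integral_exp_int_mul_I_s13 (n : ℤ) :
    ∫ θ in (0:ℝ)..(2 * Real.pi), exp (n * (θ * I)) = if n = 0 then 2 * (Real.pi : ℂ) else 0 := by
  split_ifs with h
  · simp [h]
  · have hc : (n : ℂ) * I ≠ 0 := mul_ne_zero (Int.cast_ne_zero.mpr h) I_ne_zero
    have h1 : ∀ θ : ℝ, exp (n * (θ * I)) = exp ((n * I) * θ) := fun θ => by ring_nf
    simp_rw [h1]
    rw [integral_exp_mul_complex hc]
    have h2 : (n : ℂ) * I * ((2 * Real.pi : ℝ) : ℂ) = n * (2 * Real.pi * I) := by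
      push_cast; ring
    rw [h2, exp_int_mul_two_pi_mul_I]
    simp

open Complex in
/-- One term of Bessel's inequality for an absolutely convergent trigonometric series. -/
theorem two_pi_mul_norm_sq_le_integral_norm_tsum_sq {c : ℕ → ℂ} {n : ℕ → ℕ}
    (hn : Function.Injective n) (hc : Summable fun j => ‖c j‖) (m : ℕ) :
    2 * Real.pi * ‖c m‖ ^ 2 ≤
      ∫ θ in (0:ℝ)..(2 * Real.pi), ‖∑' j, c j * exp (θ * I) ^ n j‖ ^ 2 := by
  have hnorm : ∀ (j : ℕ) (θ : ℝ), ‖c j * exp (θ * I) ^ n j‖ = ‖c j‖ := fun j θ => by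
    simp [norm_exp_ofReal_mul_I]
  have hcont : ∀ j, Continuous fun θ : ℝ => c j * exp (θ * I) ^ n j := fun j => by fun_prop
  set G : ℝ → ℂ := fun θ => ∑' j, c j * exp (θ * I) ^ n j with hG
  have hGc : Continuous G := continuous_tsum hcont hc fun j θ => (hnorm j θ).le
  set e : ℝ → ℂ := fun θ => c m * exp (θ * I) ^ n m with he
  have hconj : Continuous fun θ => (starRingEnd ℂ) (e θ) := continuous_conj.comp (hcont m)
  have hGs : ∀ θ : ℝ, HasSum (fun j => c j * exp (θ * I) ^ n j) (G θ) := fun θ =>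
    (Summable.of_norm (by simpa only [hnorm] using hc)).hasSum
  have hterm : ∀ j, ∫ θ in (0:ℝ)..(2 * Real.pi),
      c j * exp (θ * I) ^ n j * (starRingEnd ℂ) (e θ) =
        if j = m then ((2 * Real.pi * ‖c m‖ ^ 2 : ℝ) : ℂ) else 0 := by
    intro j
    have h1 : ∀ θ : ℝ, c j * exp (θ * I) ^ n j * (starRingEnd ℂ) (e θ) =
        c j * (starRingEnd ℂ) (c m) * exp (((n j - n m : ℤ) : ℂ) * (θ * I)) := by
      intro θ
      simp only [he, map_mul, ← exp_conj, conj_ofReal, conj_I, conj_natCast, ← exp_nat_mul]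
      have : exp (((n j - n m : ℤ) : ℂ) * (θ * I)) =
          exp (n j * (θ * I)) * exp (n m * (θ * -I)) := by
        rw [← exp_add]; congr 1; push_cast; ring
      rw [this]; ring
    simp_rw [h1]
    rw [intervalIntegral.integral_const_mul, integral_exp_int_mul_I_s13]
    by_cases hj : j = m
    · subst hj
      simp only [sub_self, if_true, mul_conj, normSq_eq_norm_sq]
      push_cast; ring
    · have : (n j - n m : ℤ) ≠ 0 := by
        rw [sub_ne_zero]; exact_mod_cast hn.ne hj
      simp [hj, this]
  have hint : ∫ θ in (0:ℝ)..(2 * Real.pi), G θ * (starRingEnd ℂ) (e θ) =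
      ((2 * Real.pi * ‖c m‖ ^ 2 : ℝ) : ℂ) := by
    have hs := intervalIntegral.hasSum_integral_of_dominated_convergence
      (μ := MeasureTheory.volume) (a := 0) (b := 2 * Real.pi)
      (F := fun j θ => c j * exp (θ * I) ^ n j * (starRingEnd ℂ) (e θ))
      (f := fun θ => G θ * (starRingEnd ℂ) (e θ)) (fun j _ => ‖c j‖ * ‖c m‖)
      (fun j => ((hcont j).mul hconj).aestronglyMeasurable)
      (fun j => .of_forall fun θ _ => by rw [norm_mul, hnorm, RCLike.norm_conj, hnorm])
      (.of_forall fun θ _ => hc.mul_right _)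
      (by simp)
      (.of_forall fun θ _ => (hGs θ).mul_right _)
    simp_rw [hterm] at hs
    exact hs.unique (hasSum_ite_eq m _)
  have hre : ∫ θ in (0:ℝ)..(2 * Real.pi), (G θ * (starRingEnd ℂ) (e θ)).re =
      2 * Real.pi * ‖c m‖ ^ 2 := by
    have h := reCLM.intervalIntegral_comp_comm
      ((hGc.mul hconj).intervalIntegrable (μ := MeasureTheory.volume) 0 (2 * Real.pi))
    simp only [reCLM_apply, Pi.mul_apply] at h
    rw [h, hint, ofReal_re]
  have hpt : ∀ θ, 2 * (G θ * (starRingEnd ℂ) (e θ)).re - ‖c m‖ ^ 2 ≤ ‖G θ‖ ^ 2 := by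
    intro θ
    have h1 : ‖e θ‖ ^ 2 = ‖c m‖ ^ 2 := by rw [hnorm]
    have h2 := normSq_sub (G θ) (e θ)
    have h3 := normSq_nonneg (G θ - e θ)
    rw [normSq_eq_norm_sq (G θ), normSq_eq_norm_sq (e θ)] at h2
    linarith
  have hrec : Continuous fun θ => 2 * (G θ * (starRingEnd ℂ) (e θ)).re :=
    continuous_const.mul (continuous_re.comp (hGc.mul hconj))
  have hmono := intervalIntegral.integral_mono (μ := MeasureTheory.volume) Real.two_pi_pos.le
    ((hrec.sub continuous_const).intervalIntegrable 0 (2 * Real.pi))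
    ((hGc.norm.pow 2).intervalIntegrable 0 (2 * Real.pi)) hpt
  simp only [Pi.sub_apply, Pi.pow_apply] at hmono
  rw [intervalIntegral.integral_sub (hrec.intervalIntegrable _ _) (by simp),
    intervalIntegral.integral_const_mul, hre, intervalIntegral.integral_const] at hmono
  simp only [smul_eq_mul, sub_zero] at hmono
  linarith

theorem injective_two_pow_succ : Function.Injective fun j : ℕ => 2 ^ (j + 1) :=
  (Nat.pow_right_injective le_rfl).comp (add_left_injective 1)

theorem summable_two_pow_mul_pow_sub_one {ρ : ℝ} (h0 : 0 ≤ ρ) (h1 : ρ < 1) :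
    Summable fun j : ℕ => (2 : ℝ) ^ (j + 1) * ρ ^ (2 ^ (j + 1) - 1) := by
  have h : Summable fun n : ℕ => (n : ℝ) * ρ ^ (n - 1) := by
    rw [← summable_nat_add_iff 1]
    have hρ : ‖ρ‖ < 1 := by rwa [Real.norm_of_nonneg h0]
    have := (summable_pow_mul_geometric_of_norm_lt_one 1 hρ).add
      (summable_geometric_of_lt_one h0 h1)
    refine this.congr fun n => ?_
    simp only [pow_one, Nat.add_sub_cancel]
    push_cast; ring
  refine (h.comp_injective injective_two_pow_succ).congr fun j => ?_
  simp

theorem norm_div_succ_sq_le (a : ℂ) (j : ℕ) : ‖a / ((j : ℂ) + 1) ^ 2‖ ≤ ‖a‖ := by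
  have h : ‖((j : ℂ) + 1)‖ = (j : ℝ) + 1 := by
    rw [← Nat.cast_succ, Complex.norm_natCast, Nat.cast_succ]
  rw [norm_div, norm_pow, h]
  exact div_le_self (norm_nonneg _) (one_le_pow₀ (by simp))

theorem hasDerivAt_lacunary {z : ℂ} (hz : ‖z‖ < 1) :
    HasDerivAt (fun w : ℂ => ∑' j : ℕ, w ^ (2 ^ (j + 1)) / ((j : ℂ) + 1) ^ 2)
      (∑' j : ℕ, 2 ^ (j + 1) * z ^ (2 ^ (j + 1) - 1) / ((j : ℂ) + 1) ^ 2) z := by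
  obtain ⟨ρ, hzρ, hρ⟩ := exists_between hz
  have h0 : 0 ≤ ρ := (norm_nonneg z).trans hzρ.le
  refine hasDerivAt_tsum_of_isPreconnected (t := Metric.ball (0 : ℂ) ρ) (y₀ := 0)
    (g := fun (j : ℕ) (w : ℂ) => w ^ (2 ^ (j + 1)) / ((j : ℂ) + 1) ^ 2)
    (g' := fun (j : ℕ) (w : ℂ) => 2 ^ (j + 1) * w ^ (2 ^ (j + 1) - 1) / ((j : ℂ) + 1) ^ 2)
    (summable_two_pow_mul_pow_sub_one h0 hρ) Metric.isOpen_ball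
    (convex_ball _ _).isPreconnected (fun j w _ => ?_) (fun j w hw => ?_)
    (by simpa using (norm_nonneg z).trans_lt hzρ) (by simp [summable_zero])
    (by simpa using hzρ)
  · simpa using (hasDerivAt_pow (2 ^ (j + 1)) w).div_const (((j : ℂ) + 1) ^ 2)
  · refine (norm_div_succ_sq_le _ j).trans ?_
    have hw' : ‖w‖ ≤ ρ := (mem_ball_zero_iff.mp hw).le
    rw [norm_mul, norm_pow, norm_pow, Complex.norm_ofNat]
    gcongr

/-- The logarithmic derivative `z p'(z)/p(z)` of `p = exp((i/2) ∑ z^{2^j}/j²)`. -/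
theorem mul_deriv_div_exp_lacunary {z : ℂ} (hz : ‖z‖ < 1) :
    z * deriv (fun w : ℂ =>
        Complex.exp (Complex.I / 2 * ∑' j : ℕ, w ^ (2 ^ (j + 1)) / ((j : ℂ) + 1) ^ 2)) z /
      Complex.exp (Complex.I / 2 * ∑' j : ℕ, z ^ (2 ^ (j + 1)) / ((j : ℂ) + 1) ^ 2) =
    Complex.I / 2 * ∑' j : ℕ, 2 ^ (j + 1) * z ^ (2 ^ (j + 1)) / ((j : ℂ) + 1) ^ 2 := by
  rw [((hasDerivAt_lacunary hz).const_mul (Complex.I / 2)).cexp.deriv]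
  have h : ∑' j : ℕ, 2 ^ (j + 1) * z ^ (2 ^ (j + 1)) / ((j : ℂ) + 1) ^ 2 =
      z * ∑' j : ℕ, 2 ^ (j + 1) * z ^ (2 ^ (j + 1) - 1) / ((j : ℂ) + 1) ^ 2 := by
    rw [← tsum_mul_left]
    congr 1 with j
    rw [← mul_pow_sub_one (pow_ne_zero (j + 1) two_ne_zero) z]
    ring
  rw [h, div_eq_iff (Complex.exp_ne_zero _)]
  ring

theorem le_Ip_exp_lacunary {r : ℝ} (h0 : 0 ≤ r) (h1 : r < 1) (m : ℕ) :
    2 * Real.pi * (2 ^ (m + 1) * r ^ (2 ^ (m + 1)) / (2 * ((m : ℝ) + 1) ^ 2)) ^ 2 ≤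
      Ip (fun w : ℂ =>
        Complex.exp (Complex.I / 2 * ∑' j : ℕ, w ^ (2 ^ (j + 1)) / ((j : ℂ) + 1) ^ 2)) r := by
  set c : ℕ → ℂ := fun j =>
    Complex.I / 2 * (2 ^ (j + 1) * (r : ℂ) ^ (2 ^ (j + 1)) / ((j : ℂ) + 1) ^ 2) with hcdef
  have hc : Summable fun j => ‖c j‖ := by
    refine ((summable_two_pow_mul_pow_sub_one h0 h1).mul_left (1 / 2 * r)).of_nonneg_of_le
      (fun _ => norm_nonneg _) fun j => ?_
    have h := norm_div_succ_sq_le (2 ^ (j + 1) * (r : ℂ) ^ (2 ^ (j + 1))) j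
    have h2 : ‖(2 : ℂ) ^ (j + 1) * (r : ℂ) ^ (2 ^ (j + 1))‖ =
        r * (2 ^ (j + 1) * r ^ (2 ^ (j + 1) - 1)) := by
      rw [norm_mul, norm_pow, norm_pow, Complex.norm_ofNat, Complex.norm_of_nonneg h0,
        ← mul_pow_sub_one (pow_ne_zero (j + 1) two_ne_zero) r]
      ring
    have h3 : ‖Complex.I / 2‖ = 1 / 2 := by simp
    rw [norm_mul, h3, mul_assoc, ← h2]
    gcongr
  have hm : ‖c m‖ = 2 ^ (m + 1) * r ^ (2 ^ (m + 1)) / (2 * ((m : ℝ) + 1) ^ 2) := by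
    have h : ‖((m : ℂ) + 1)‖ = (m : ℝ) + 1 := by
      rw [← Nat.cast_succ, Complex.norm_natCast, Nat.cast_succ]
    simp only [hcdef, norm_mul, norm_div, norm_pow, h, Complex.norm_of_nonneg h0,
      Complex.norm_I, Complex.norm_ofNat]
    field_simp
  rw [← hm]
  refine (two_pi_mul_norm_sq_le_integral_norm_tsum_sq injective_two_pow_succ hc m).trans_eq ?_
  unfold Ip
  congr 1 with θ
  have hz : ‖(r : ℂ) * Complex.exp (θ * Complex.I)‖ < 1 := by
    rwa [norm_mul, Complex.norm_exp_ofReal_mul_I, mul_one, Complex.norm_of_nonneg h0]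
  rw [mul_deriv_div_exp_lacunary hz, ← tsum_mul_left]
  congr 3 with j
  simp only [hcdef, mul_pow]
  ring

/-- For `p*(z) = exp((i/2) ∑_{k≥1} z^{2^k}/k²)` and `r_k = e^{-2^{-k}}`, `k ≥ 1`:
`r_k^{2^{k+1}} = e^{-2}`, `2^{-k-1} ≤ 1 - r_k ≤ 2^{-k}`, and
`I_{p*}(r_k) ≥ 2π e^{-2} 4^{k-1}/k⁴`. -/
theorem stmt13 (k : ℕ) (hk : 1 ≤ k) :
    (Real.exp (-(1 / 2 ^ k))) ^ (2 ^ (k + 1)) = Real.exp (-2) ∧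
    ((1 : ℝ) / 2) ^ (k + 1) ≤ 1 - Real.exp (-(1 / 2 ^ k)) ∧
    1 - Real.exp (-(1 / 2 ^ k)) ≤ ((1 : ℝ) / 2) ^ k ∧
    2 * Real.pi * Real.exp (-2) * (4 : ℝ) ^ (k - 1) / (k : ℝ) ^ 4 ≤
      Ip (fun w : ℂ =>
            Complex.exp (Complex.I / 2 * ∑' j : ℕ, w ^ (2 ^ (j + 1)) / ((j : ℂ) + 1) ^ 2))
        (Real.exp (-(1 / 2 ^ k))) := by
  have hx0 : (0 : ℝ) < 1 / 2 ^ k := by positivity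
  have hx1 : (1 : ℝ) / 2 ^ k ≤ 1 := by
    rw [div_le_one (by positivity)]
    exact one_le_pow₀ one_le_two
  have hxk : ((1 : ℝ) / 2) ^ k = 1 / 2 ^ k := by rw [div_pow, one_pow]
  have hpow : Real.exp (-(1 / 2 ^ k)) ^ (2 ^ (k + 1)) = Real.exp (-2) := by
    rw [← Real.exp_nat_mul]
    congr 1
    push_cast
    rw [pow_succ]
    field_simp
  refine ⟨hpow, ?_, ?_, ?_⟩
  · rw [pow_succ, hxk]
    have h := Real.add_one_le_exp (1 / 2 ^ k : ℝ)
    have h2 : Real.exp (-(1 / 2 ^ k)) ≤ (1 / 2 ^ k + 1)⁻¹ := by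
      rw [Real.exp_neg]
      exact inv_anti₀ (by positivity) h
    have h3 : ((1 : ℝ) / 2 ^ k + 1)⁻¹ ≤ 1 - 1 / 2 ^ k * (1 / 2) := by
      rw [inv_le_iff_one_le_mul₀ (by positivity)]
      nlinarith
    linarith
  · rw [hxk]
    linarith [Real.add_one_le_exp (-(1 / 2 ^ k : ℝ))]
  · obtain ⟨m, rfl⟩ := Nat.exists_eq_add_of_le' hk
    refine le_trans (le_of_eq ?_)
      (le_Ip_exp_lacunary (Real.exp_pos _).le (Real.exp_lt_one_iff.mpr (by linarith)) m)
    have hsq : (Real.exp (-(1 / 2 ^ (m + 1))) ^ (2 ^ (m + 1))) ^ 2 = Real.exp (-2) := by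
      rw [← pow_mul, ← pow_succ, hpow]
    have h4 : (4 : ℝ) ^ m = (2 ^ m) ^ 2 := by rw [← pow_mul, mul_comm, pow_mul]; norm_num
    rw [← hsq, Nat.add_sub_cancel, h4, pow_succ (2 : ℝ) m]
    push_cast
    field_simp
end
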